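/- The optimal value of the two-hop inner problem is a concave function of the relay decoding power strategy: the function R(δ) := sup{ ∑_{i=1}^N r̃_i : (r, r̃) feasible for the inner problem with strategy δ } is concave on the convex set Δ = { δ ∈ [0,∞)^N : ∑_{i=1}^k δ_i ≤ ∑_{i=1}^k Ẽ_i for all k = 1,…,N }. -/

import Mathlib

open Finset

/-- Feasibility of a pair (source rates `r`, relay rates `rt`) for the two-hop inner
problem with source energies `E`, relay energies `Et`, destination energies `Ebar`,
relay decoding power strategy `δ`, rate-to-power function `f` and decoding cost `φ`. -/
def InnerFeasible (N : ℕ) (E Et Ebar δ : ℕ → ℝ) (f φ : ℝ → ℝ) (r rt : ℕ → ℝ) : Prop :=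
  (∀ i ∈ Finset.Icc 1 N, 0 ≤ r i) ∧
  (∀ i ∈ Finset.Icc 1 N, 0 ≤ rt i) ∧
  (∀ k ∈ Finset.Icc 1 N,
      ∑ i ∈ Finset.Icc 1 k, f (r i) ≤ ∑ i ∈ Finset.Icc 1 k, E i) ∧
  (∀ k ∈ Finset.Icc 1 N,
      ∑ i ∈ Finset.Icc 1 k, φ (r i) ≤ ∑ i ∈ Finset.Icc 1 k, δ i) ∧
  (∀ k ∈ Finset.Icc 1 N,
      ∑ i ∈ Finset.Icc 1 k, f (rt i) ≤ ∑ i ∈ Finset.Icc 1 k, (Et i - δ i)) ∧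
  (∀ k ∈ Finset.Icc 1 N,
      ∑ i ∈ Finset.Icc 1 k, rt i ≤ ∑ i ∈ Finset.Icc 1 k, r i) ∧
  (∀ k ∈ Finset.Icc 1 N,
      ∑ i ∈ Finset.Icc 1 k, φ (rt i) ≤ ∑ i ∈ Finset.Icc 1 k, Ebar i)

open scoped Pointwise

/-- Convex combinations respect partial-sum constraints with convex cost. -/
lemma sum_convex_comb_le (g : ℝ → ℝ) (hg : ConvexOn ℝ (Set.Ici 0) g) (N k : ℕ) (hk : k ∈ Finset.Icc 1 N)
    (u v p q w : ℕ → ℝ) (a b : ℝ) (ha : 0 ≤ a) (hb : 0 ≤ b) (hab : a + b = 1)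
    (hu : ∀ i ∈ Finset.Icc 1 N, 0 ≤ u i) (hv : ∀ i ∈ Finset.Icc 1 N, 0 ≤ v i)
    (h1 : ∑ i ∈ Finset.Icc 1 k, g (u i) ≤ ∑ i ∈ Finset.Icc 1 k, p i)
    (h2 : ∑ i ∈ Finset.Icc 1 k, g (v i) ≤ ∑ i ∈ Finset.Icc 1 k, q i)
    (hw : ∀ i, w i = a * p i + b * q i) :
    ∑ i ∈ Finset.Icc 1 k, g (a * u i + b * v i) ≤ ∑ i ∈ Finset.Icc 1 k, w i := by
  have hkN := (Finset.mem_Icc.1 hk).2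
  calc ∑ i ∈ Finset.Icc 1 k, g (a * u i + b * v i)
      ≤ ∑ i ∈ Finset.Icc 1 k, (a * g (u i) + b * g (v i)) := by
        apply Finset.sum_le_sum
        intro i hi
        have hi' : i ∈ Finset.Icc 1 N := by
          rw [Finset.mem_Icc] at hi ⊢
          omega
        have := hg.2 (hu i hi') (hv i hi') ha hb hab
        simpa only [smul_eq_mul] using this
    _ = a * ∑ i ∈ Finset.Icc 1 k, g (u i) + b * ∑ i ∈ Finset.Icc 1 k, g (v i) := by
        rw [Finset.sum_add_distrib, Finset.mul_sum, Finset.mul_sum]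
    _ ≤ a * ∑ i ∈ Finset.Icc 1 k, p i + b * ∑ i ∈ Finset.Icc 1 k, q i :=
        add_le_add (mul_le_mul_of_nonneg_left h1 ha) (mul_le_mul_of_nonneg_left h2 hb)
    _ = ∑ i ∈ Finset.Icc 1 k, w i := by
        rw [Finset.sum_congr rfl (fun i _ => hw i), Finset.sum_add_distrib, Finset.mul_sum,
          Finset.mul_sum]

/-- A convex combination of feasible points is feasible for the combined strategy. -/
lemma InnerFeasible.combo {N : ℕ} {E Et Ebar x y : ℕ → ℝ} {f φ : ℝ → ℝ}
    (hf : ConvexOn ℝ (Set.Ici 0) f) (hφ : ConvexOn ℝ (Set.Ici 0) φ)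
    {r rt s st : ℕ → ℝ} (h1 : InnerFeasible N E Et Ebar x f φ r rt)
    (h2 : InnerFeasible N E Et Ebar y f φ s st) {a b : ℝ}
    (ha : 0 ≤ a) (hb : 0 ≤ b) (hab : a + b = 1) :
    InnerFeasible N E Et Ebar (a • x + b • y) f φ
      (fun i => a * r i + b * s i) (fun i => a * rt i + b * st i) := by
  obtain ⟨a1, a2, a3, a4, a5, a6, a7⟩ := h1
  obtain ⟨b1, b2, b3, b4, b5, b6, b7⟩ := h2
  have hc : ∀ z : ℝ, z = a * z + b * z := fun z => by rw [← add_mul, hab, one_mul]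
  refine ⟨?_, ?_, ?_, ?_, ?_, ?_, ?_⟩
  · exact fun i hi => add_nonneg (mul_nonneg ha (a1 i hi)) (mul_nonneg hb (b1 i hi))
  · exact fun i hi => add_nonneg (mul_nonneg ha (a2 i hi)) (mul_nonneg hb (b2 i hi))
  · exact fun k hk => sum_convex_comb_le f hf N k hk r s E E E a b ha hb hab a1 b1 (a3 k hk)
      (b3 k hk) (fun i => hc _)
  · exact fun k hk => sum_convex_comb_le φ hφ N k hk r s x y _ a b ha hb hab a1 b1 (a4 k hk)
      (b4 k hk) (fun i => by simp)
  · refine fun k hk => sum_convex_comb_le f hf N k hk rt st _ _ _ a b ha hb hab a2 b2 (a5 k hk)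
      (b5 k hk) (fun i => ?_)
    have := hc (Et i)
    simp only [Pi.add_apply, Pi.smul_apply, smul_eq_mul]
    linarith
  · exact fun k hk => sum_convex_comb_le id (convexOn_id (convex_Ici 0)) N k hk rt st r s _ a b
      ha hb hab a2 b2 (a6 k hk) (b6 k hk) (fun i => rfl)
  · exact fun k hk => sum_convex_comb_le φ hφ N k hk rt st _ _ _ a b ha hb hab a2 b2 (a7 k hk)
      (b7 k hk) (fun i => hc _)

/-- Linear growth of a convex increasing function vanishing at zero. -/
lemma le_one_add_div_of_convex {f : ℝ → ℝ} (hf : ConvexOn ℝ (Set.Ici 0) f) (hf0 : f 0 = 0)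
    (hnn : ∀ x : ℝ, 0 ≤ x → 0 ≤ f x) (h1 : 0 < f 1) {x : ℝ} (hx : 0 ≤ x) :
    x ≤ 1 + f x / f 1 := by
  rcases le_total x 1 with h | h
  · have := div_nonneg (hnn x hx) h1.le
    linarith
  · have hx0 : 0 < x := by linarith
    have hinv : x⁻¹ ≤ 1 := inv_le_one_of_one_le₀ h
    have key := hf.2 (show x ∈ Set.Ici (0:ℝ) from hx) (show (0:ℝ) ∈ Set.Ici (0:ℝ) from Set.mem_Ici.2 (le_refl _))
      (inv_nonneg.2 hx) (sub_nonneg.2 hinv) (by ring)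
    simp only [smul_eq_mul, mul_zero, add_zero, hf0, inv_mul_cancel₀ hx0.ne'] at key
    have h2 : x * f 1 ≤ f x := by
      have := mul_le_mul_of_nonneg_left key hx
      rwa [← mul_assoc, mul_inv_cancel₀ hx0.ne', one_mul] at this
    have := (le_div_iff₀ h1).2 h2
    linarith

/-- the optimal value `R(δ)` of the two-hop inner problem is a concave
function of the relay decoding power strategy `δ` on the set `Δ` of feasible strategies. -/
theorem twohop_value_concave
    (N : ℕ) (hN : 1 ≤ N)
    (E Et Ebar : ℕ → ℝ)
    (hE : ∀ i ∈ Finset.Icc 1 N, 0 ≤ E i)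
    (hEt : ∀ i ∈ Finset.Icc 1 N, 0 ≤ Et i)
    (hEbar : ∀ i ∈ Finset.Icc 1 N, 0 ≤ Ebar i)
    (f φ : ℝ → ℝ)
    (hf_cont : ContinuousOn f (Set.Ici 0))
    (hf_mono : StrictMonoOn f (Set.Ici 0))
    (hf_conv : StrictConvexOn ℝ (Set.Ici 0) f)
    (hf_nonneg : ∀ x : ℝ, 0 ≤ x → 0 ≤ f x)
    (hf0 : f 0 = 0)
    (hphi_cont : ContinuousOn φ (Set.Ici 0))
    (hphi_mono : StrictMonoOn φ (Set.Ici 0))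
    (hphi_conv : StrictConvexOn ℝ (Set.Ici 0) φ)
    (hphi_nonneg : ∀ x : ℝ, 0 ≤ x → 0 ≤ φ x)
    (hphi0 : φ 0 = 0) :
    ConcaveOn ℝ
      {δ : ℕ → ℝ | (∀ i ∈ Finset.Icc 1 N, 0 ≤ δ i) ∧
        (∀ k ∈ Finset.Icc 1 N,
            ∑ i ∈ Finset.Icc 1 k, δ i ≤ ∑ i ∈ Finset.Icc 1 k, Et i)}
      (fun δ => sSup {S : ℝ | ∃ r rt : ℕ → ℝ,
          InnerFeasible N E Et Ebar δ f φ r rt ∧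
          S = ∑ i ∈ Finset.Icc 1 N, rt i}) := by
  have hf1 : 0 < f 1 := by
    have := hf_mono (show (0:ℝ) ∈ Set.Ici (0:ℝ) from Set.mem_Ici.2 (le_refl _))
      (show (1:ℝ) ∈ Set.Ici (0:ℝ) from Set.mem_Ici.2 zero_le_one) zero_lt_one
    rwa [hf0] at this
  refine ⟨?_, ?_⟩
  · rintro x ⟨hx1, hx2⟩ y ⟨hy1, hy2⟩ a b ha hb hab
    refine ⟨fun i hi => ?_, fun k hk => ?_⟩
    · exact add_nonneg (mul_nonneg ha (hx1 i hi)) (mul_nonneg hb (hy1 i hi))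
    · exact sum_convex_comb_le id (convexOn_id (convex_Ici 0)) N k hk x y Et Et Et a b
        ha hb hab hx1 hy1 (hx2 k hk) (hy2 k hk) (fun i => by rw [← add_mul, hab, one_mul])
  · set A : (ℕ → ℝ) → Set ℝ := fun δ => {S : ℝ | ∃ r rt : ℕ → ℝ,
          InnerFeasible N E Et Ebar δ f φ r rt ∧
          S = ∑ i ∈ Finset.Icc 1 N, rt i} with hA
    have hbdd : ∀ δ, BddAbove (A δ) := by
      intro δ
      refine ⟨∑ i ∈ Finset.Icc 1 N, (1:ℝ) + (∑ i ∈ Finset.Icc 1 N, (Et i - δ i)) / f 1, ?_⟩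
      rintro S ⟨r, rt, h, rfl⟩
      have h5 := h.2.2.2.2.1 N (Finset.mem_Icc.2 ⟨hN, le_refl _⟩)
      calc ∑ i ∈ Finset.Icc 1 N, rt i ≤ ∑ i ∈ Finset.Icc 1 N, (1 + f (rt i) / f 1) :=
            Finset.sum_le_sum fun i hi =>
              le_one_add_div_of_convex hf_conv.convexOn hf0 hf_nonneg hf1 (h.2.1 i hi)
        _ = ∑ i ∈ Finset.Icc 1 N, (1:ℝ) + (∑ i ∈ Finset.Icc 1 N, f (rt i)) / f 1 := by
            rw [Finset.sum_add_distrib, Finset.sum_div]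
        _ ≤ _ := by gcongr
    have hsub : ∀ k ∈ Finset.Icc 1 N, ∀ i ∈ Finset.Icc 1 k, i ∈ Finset.Icc 1 N := by
      intro k hk i hi
      rw [Finset.mem_Icc] at *
      omega
    have hne : ∀ δ : ℕ → ℝ, (∀ i ∈ Finset.Icc 1 N, 0 ≤ δ i) →
        (∀ k ∈ Finset.Icc 1 N,
            ∑ i ∈ Finset.Icc 1 k, δ i ≤ ∑ i ∈ Finset.Icc 1 k, Et i) → (A δ).Nonempty := by
      intro δ h1 h2
      refine ⟨_, fun _ => 0, fun _ => 0, ⟨fun _ _ => le_refl _, fun _ _ => le_refl _,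
        ?_, ?_, ?_, fun _ _ => le_refl _, ?_⟩, rfl⟩
      · intro k hk
        simp only [hf0, Finset.sum_const_zero]
        exact Finset.sum_nonneg fun i hi => hE i (hsub k hk i hi)
      · intro k hk
        simp only [hphi0, Finset.sum_const_zero]
        exact Finset.sum_nonneg fun i hi => h1 i (hsub k hk i hi)
      · intro k hk
        simp only [hf0, Finset.sum_const_zero, Finset.sum_sub_distrib]
        exact sub_nonneg.2 (h2 k hk)
      · intro k hk
        simp only [hphi0, Finset.sum_const_zero]
        exact Finset.sum_nonneg fun i hi => hEbar i (hsub k hk i hi)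
    rintro x ⟨hx1, hx2⟩ y ⟨hy1, hy2⟩ a b ha hb hab
    change a • sSup (A x) + b • sSup (A y) ≤ sSup (A (a • x + b • y))
    rw [← Real.sSup_smul_of_nonneg ha, ← Real.sSup_smul_of_nonneg hb,
      ← csSup_add ((hne x hx1 hx2).smul_set) ((hbdd x).smul_of_nonneg ha)
        ((hne y hy1 hy2).smul_set) ((hbdd y).smul_of_nonneg hb)]
    refine csSup_le_csSup (hbdd _) ((hne x hx1 hx2).smul_set.add (hne y hy1 hy2).smul_set) ?_
    rintro _ ⟨_, ⟨_, ⟨r, rt, h1, rfl⟩, rfl⟩, _, ⟨_, ⟨s, st, h2, rfl⟩, rfl⟩, rfl⟩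
    refine ⟨_, _, h1.combo hf_conv.convexOn hphi_conv.convexOn h2 ha hb hab, ?_⟩
    simp only [smul_eq_mul]
    rw [Finset.sum_add_distrib, Finset.mul_sum, Finset.mul_sum]
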